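/- For ε ∈ (0,1/2), x ∈ ℝ, and Δ > Δ_min = 2·Φ⁻¹(1/(2(1-ε))), the function Δ ↦ kl^ε_G(x, x+Δ) is differentiable with derivative ∂/∂Δ kl^ε_G(x,x+Δ) = (1-ε)·Δ·(Φ(Δ₊/2) - Φ(Δ₋/2)) > 0, where c solves 1/(1-ε) = c·Φ(Δ₋/2) + Φ(Δ₊/2) with Δ₊ = Δ + (2/Δ)log(1/c), Δ₋ = Δ - (2/Δ)log(1/c). In particular kl^ε_G(x, x+Δ) is strictly increasing in Δ on (Δ_min, ∞). -/

import Mathlib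

open MeasureTheory ProbabilityTheory Real Set
open scoped ENNReal

noncomputable section

/-- Standard normal probability density function. -/
def stdphi (x : ℝ) : ℝ := (Real.sqrt (2 * Real.pi))⁻¹ * Real.exp (-x ^ 2 / 2)

/-- Standard normal cumulative distribution function. -/
def stdPhi (x : ℝ) : ℝ := ((gaussianReal 0 1) (Set.Iic x)).toReal

/-- Standard normal quantile function. -/
def stdPhiInv (p : ℝ) : ℝ := sInf {x : ℝ | p ≤ stdPhi x}

/-- Minimum distinction gap under corruption, `Δ_min = 2 Φ⁻¹(1/(2(1-ε)))`. -/
def Dmin (ε : ℝ) : ℝ := 2 * stdPhiInv (1 / (2 * (1 - ε)))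

/-- `ε`-corrupted mixture `(1-ε) μ + ε H` of two measures on `ℝ`. -/
def mix (ε : ℝ) (μ H : Measure ℝ) : Measure ℝ :=
  ENNReal.ofReal (1 - ε) • μ + ENNReal.ofReal ε • H

open Classical in
/-- Kullback–Leibler divergence. -/
def KLdiv (P Q : Measure ℝ) : ℝ≥0∞ :=
  if P ≪ Q ∧ Integrable (fun x => Real.log (P.rnDeriv Q x).toReal) P then
    ENNReal.ofReal (∫ x, Real.log (P.rnDeriv Q x).toReal ∂P) else ⊤

/-- Corrupted Gaussian divergence `kl^ε_G(x, y)`: the infimum over pairs of corruption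
distributions of the KL divergence between the corrupted unit-variance Gaussians. -/
def klG (ε x y : ℝ) : ℝ≥0∞ :=
  ⨅ (H : Measure ℝ) (_ : IsProbabilityMeasure H) (H' : Measure ℝ)
    (_ : IsProbabilityMeasure H'),
    KLdiv (mix ε (gaussianReal x 1) H) (mix ε (gaussianReal y 1) H')

/-- (Lower) median of a probability measure on `ℝ`. -/
def measMed (μ : Measure ℝ) : ℝ := sInf {x : ℝ | 1 / 2 ≤ (μ (Set.Iic x)).toReal}

/-- Quantile function of a probability measure on `ℝ`. -/
def quantile (μ : Measure ℝ) (p : ℝ) : ℝ := sInf {x : ℝ | p ≤ (μ (Set.Iic x)).toReal}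

/-- Empirical median of a finite sample. -/
def empMed {n : ℕ} (X : Fin n → ℝ) : ℝ :=
  sInf {x : ℝ | (n : ℝ) ≤ 2 * Nat.card {i : Fin n // X i ≤ x}}

/-- The variance proxy `s_ε` for the concentration of the median under corruption. -/
def sEps (ε : ℝ) : ℝ :=
  (Real.sqrt (ε / 2 / Real.log (1 / (1 - 2 * ε))) +
      Real.sqrt ((1 - 2 * ε) / (4 * Real.log ((1 - ε) / ε)))) /
    ((1 - ε) * stdphi (Dmin ε / 2 + 1))

/-- Mean of a measure on `ℝ`. -/
def meanOf (μ : Measure ℝ) : ℝ := ∫ x, x ∂μ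

/-- Corrupted KL-inf `KL^ε_inf(η, x; L)`. -/
def KLinf (ε : ℝ) (η : Measure ℝ) (x : ℝ) (L : Set (Measure ℝ)) : ℝ≥0∞ :=
  ⨅ (κ : Measure ℝ) (_ : κ ∈ L) (_ : x ≤ meanOf κ) (H : Measure ℝ)
    (_ : IsProbabilityMeasure H) (H' : Measure ℝ) (_ : IsProbabilityMeasure H'),
    KLdiv (mix ε η H) (mix ε κ H')

lemma stdphi_eq : stdphi = gaussianPDFReal 0 1 := by
  ext x; simp [stdphi, gaussianPDFReal]

lemma stdphi_cont : Continuous stdphi := by unfold stdphi; fun_prop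

lemma stdphi_pos (x : ℝ) : 0 < stdphi x := by unfold stdphi; positivity

lemma stdphi_integrable : Integrable stdphi := by
  rw [stdphi_eq]; exact integrable_gaussianPDFReal 0 1

lemma stdPhi_eq (x : ℝ) : stdPhi x = ∫ t in Iic x, stdphi t := by
  rw [stdPhi, gaussianReal_apply_eq_integral 0 one_ne_zero, ENNReal.toReal_ofReal, stdphi_eq]
  exact integral_nonneg fun t => gaussianPDFReal_nonneg _ _ _

lemma stdPhi_strictDeriv (x : ℝ) : HasStrictDerivAt stdPhi (stdphi x) x := by
  have h : stdPhi = fun u => stdPhi 0 + ∫ t in (0:ℝ)..u, stdphi t := by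
    ext u
    rw [stdPhi_eq, stdPhi_eq, ← intervalIntegral.integral_Iic_sub_Iic
      stdphi_integrable.integrableOn stdphi_integrable.integrableOn]
    ring
  rw [h]
  exact (stdphi_cont.integral_hasStrictDerivAt 0 x).const_add _

lemma stdphi_strictDeriv (x : ℝ) : HasStrictDerivAt stdphi (-x * stdphi x) x := by
  have h : ContDiff ℝ 1 stdphi := by unfold stdphi; fun_prop
  have h1 : HasDerivAt stdphi (-x * stdphi x) x := by
    have := ((((hasDerivAt_id x).pow 2).neg.div_const 2).exp).const_mul ((Real.sqrt (2 * Real.pi))⁻¹)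
    refine this.congr_deriv ?_
    simp [stdphi]; ring
  have h2 := h.contDiffAt.hasStrictDerivAt (x := x) one_ne_zero
  rwa [h1.deriv] at h2

lemma stdPhi_strictMono : StrictMono stdPhi := by
  apply strictMono_of_deriv_pos
  intro x
  rw [(stdPhi_strictDeriv x).hasDerivAt.deriv]; exact stdphi_pos x

lemma stdPhi_pos (x : ℝ) : 0 < stdPhi x :=
  lt_of_le_of_lt ENNReal.toReal_nonneg (stdPhi_strictMono (sub_one_lt x))

lemma gauss_Iic (m t : ℝ) : (gaussianReal m 1).real (Iic t) = stdPhi (t - m) := by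
  have h := gaussianReal_map_add_const (μ := 0) (v := 1) m
  rw [zero_add] at h
  rw [stdPhi, ← h, measureReal_def, Measure.map_apply (by fun_prop) measurableSet_Iic]
  congr 2
  ext y; simp [le_sub_iff_add_le]

lemma gauss_Ioi (m t : ℝ) : (gaussianReal m 1).real (Ioi t) = 1 - stdPhi (t - m) := by
  rw [← gauss_Iic, ← compl_Iic, probReal_compl_eq_one_sub measurableSet_Iic]

lemma gauss_Ici (m t : ℝ) : (gaussianReal m 1).real (Ici t) = 1 - stdPhi (t - m) := by
  have : NullSingletonClass (gaussianReal m 1) := nullSingletonClass_gaussianReal one_ne_zero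
  rw [← gauss_Ioi, measureReal_congr Ioi_ae_eq_Ici]

lemma stdPhi_neg (t : ℝ) : stdPhi (-t) = 1 - stdPhi t := by
  have h := gaussianReal_map_neg (μ := 0) (v := 1)
  rw [neg_zero] at h
  have h2 := gauss_Ici 0 t
  rw [sub_zero] at h2
  rw [← h2, stdPhi, ← h, measureReal_def, Measure.map_apply (by fun_prop) measurableSet_Iic, h]
  congr 2
  ext y; simp

lemma stdPhi_tendsto : Filter.Tendsto stdPhi Filter.atTop (nhds 1) := by
  have := tendsto_measure_Iic_atTop (gaussianReal 0 1)
  have h2 : stdPhi = fun x => ((gaussianReal 0 1) (Iic x)).toReal := rfl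
  rw [h2]
  simpa [Function.comp_def] using (ENNReal.tendsto_toReal (by simp)).comp this

lemma half_lt_of_Dmin {ε Δ : ℝ} (hε : ε ∈ Set.Ioo (0 : ℝ) (1 / 2)) (h : Dmin ε < Δ) :
    0 < Δ ∧ 1 / (1 - ε) < 2 * stdPhi (Δ / 2) := by
  obtain ⟨h0, h1⟩ := hε
  have hp : 1 / (2 * (1 - ε)) < 1 := by rw [div_lt_one (by linarith)]; linarith
  have hp2 : 1 / 2 < 1 / (2 * (1 - ε)) := by
    apply one_div_lt_one_div_of_lt <;> linarith
  have hne : {x : ℝ | 1 / (2 * (1 - ε)) ≤ stdPhi x}.Nonempty := by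
    obtain ⟨x, hx⟩ := (stdPhi_tendsto.eventually (lt_mem_nhds hp)).exists
    exact ⟨x, hx.le⟩
  have h' : sInf {x : ℝ | 1 / (2 * (1 - ε)) ≤ stdPhi x} < Δ / 2 := by
    unfold Dmin stdPhiInv at h; linarith
  obtain ⟨y, hy, hyl⟩ := exists_lt_of_csInf_lt hne h'
  have h3 : 1 / (2 * (1 - ε)) < stdPhi (Δ / 2) := lt_of_le_of_lt hy (stdPhi_strictMono hyl)
  have h4 := stdPhi_neg 0
  rw [neg_zero] at h4
  have h5 : (0:ℝ) < Δ / 2 := stdPhi_strictMono.lt_iff_lt.1 (by linarith)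
  refine ⟨by linarith, ?_⟩
  have : 1 / (1 - ε) = 2 * (1 / (2 * (1 - ε))) := by
    field_simp
  linarith

lemma mix_prob {ε : ℝ} (hε : ε ∈ Set.Ioo (0 : ℝ) 1) (μ H : Measure ℝ) [IsProbabilityMeasure μ]
    [IsProbabilityMeasure H] : IsProbabilityMeasure (mix ε μ H) := by
  constructor
  simp only [mix, Measure.add_apply, Measure.smul_apply, measure_univ, smul_eq_mul, mul_one]
  rw [← ENNReal.ofReal_add (by linarith [hε.2]) hε.1.le]; simp

lemma integral_mix {ε : ℝ} (hε : ε ∈ Set.Ioo (0 : ℝ) 1) (μ H : Measure ℝ) {f : ℝ → ℝ}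
    (h1 : Integrable f μ) (h2 : Integrable f H) :
    ∫ t, f t ∂(mix ε μ H) = (1 - ε) * ∫ t, f t ∂μ + ε * ∫ t, f t ∂H := by
  rw [mix, integral_add_measure (h1.smul_measure (by simp)) (h2.smul_measure (by simp)),
    integral_smul_measure, integral_smul_measure, ENNReal.toReal_ofReal (by linarith [hε.2]),
    ENNReal.toReal_ofReal hε.1.le]
  simp

lemma gibbs (P Q : Measure ℝ) [IsProbabilityMeasure P] [IsProbabilityMeasure Q] (hPQ : P ≪ Q)
    (hi : Integrable (llr P Q) P) : 0 ≤ ∫ t, llr P Q t ∂P := by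
  have := InformationTheory.integral_llr_add_sub_measure_univ_nonneg hPQ hi
  simpa using this

lemma dv (P Q : Measure ℝ) [IsProbabilityMeasure P] [IsProbabilityMeasure Q] (hPQ : P ≪ Q)
    (hi : Integrable (llr P Q) P) {f : ℝ → ℝ} (hf : Integrable f P)
    (hfe : Integrable (fun t => exp (f t)) Q) :
    ∫ t, f t ∂P + 1 - ∫ t, exp (f t) ∂Q ≤ ∫ t, llr P Q t ∂P := by
  have := isProbabilityMeasure_tilted hfe
  have h1 := integral_llr_tilted_right hPQ hf hfe hi
  have h2 := gibbs P (Q.tilted f) (hPQ.trans (absolutelyContinuous_tilted hfe))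
    (integrable_llr_tilted_right hPQ hf hi hfe)
  have h3 := Real.log_le_sub_one_of_pos (integral_exp_pos hfe)
  linarith

lemma bdd_int {f : ℝ → ℝ} (hf : Measurable f) {L : ℝ} (h1 : ∀ t, -L ≤ f t) (h2 : ∀ t, f t ≤ L)
    (μ : Measure ℝ) [IsFiniteMeasure μ] : Integrable f μ :=
  Integrable.of_bound hf.aestronglyMeasurable L
    (Filter.Eventually.of_forall fun t => abs_le.2 ⟨h1 t, h2 t⟩)

lemma bdd_int_exp {f : ℝ → ℝ} (hf : Measurable f) {L : ℝ} (h2 : ∀ t, f t ≤ L)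
    (μ : Measure ℝ) [IsFiniteMeasure μ] : Integrable (fun t => exp (f t)) μ :=
  Integrable.of_bound (by fun_prop) (exp L)
    (Filter.Eventually.of_forall fun t => by simpa [abs_of_pos (exp_pos _)] using h2 t)

lemma klG_eq {ε x y L : ℝ} (hε : ε ∈ Set.Ioo (0 : ℝ) 1) (H H' : Measure ℝ)
    [IsProbabilityMeasure H] [IsProbabilityMeasure H'] {f : ℝ → ℝ} (hf : Measurable f)
    (h1 : ∀ t, -L ≤ f t) (h2 : ∀ t, f t ≤ L) (hH : ∀ᵐ t ∂H, f t = -L) (hH' : ∀ᵐ t ∂H', f t = L)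
    (hd : mix ε (gaussianReal x 1) H =
      (mix ε (gaussianReal y 1) H').withDensity fun t => ENNReal.ofReal (exp (f t))) :
    (klG ε x y).toReal = (1 - ε) * ∫ t, f t ∂(gaussianReal x 1) - ε * L := by
  have iP := mix_prob hε (gaussianReal x 1) H
  have iQ := mix_prob hε (gaussianReal y 1) H'
  set P := mix ε (gaussianReal x 1) H with hP
  set Q := mix ε (gaussianReal y 1) H' with hQ
  have hac : P ≪ Q := by rw [hd]; exact withDensity_absolutelyContinuous _ _
  have hl : llr P Q =ᵐ[P] f := by
    have : P.rnDeriv Q =ᵐ[Q] fun t => ENNReal.ofReal (exp (f t)) := by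
      rw [hd]; exact Measure.rnDeriv_withDensity _ (by fun_prop)
    filter_upwards [hac.ae_le this] with t ht
    rw [llr, ht, ENNReal.toReal_ofReal (exp_pos _).le, log_exp]
  have hfP := bdd_int hf h1 h2 P
  have hfx := bdd_int hf h1 h2 (gaussianReal x 1)
  have hfH := bdd_int hf h1 h2 H
  have hi : Integrable (llr P Q) P := (integrable_congr hl).2 hfP
  have hV : ∫ t, llr P Q t ∂P = (1 - ε) * ∫ t, f t ∂(gaussianReal x 1) - ε * L := by
    rw [integral_congr_ae hl, hP, integral_mix hε _ _ hfx hfH, integral_congr_ae hH]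
    simp; ring
  have he : (1 - ε) * ∫ t, exp (f t) ∂(gaussianReal y 1) + ε * exp L = 1 := by
    have e1 : ∫ t, exp (f t) ∂Q = 1 := by
      have := iP.measure_univ
      rw [hd, withDensity_apply _ MeasurableSet.univ, Measure.restrict_univ] at this
      rw [integral_eq_lintegral_of_nonneg_ae (Filter.Eventually.of_forall fun t => (exp_pos _).le)
        (by fun_prop), this]; simp
    rw [hQ, integral_mix hε _ _ (bdd_int_exp hf h2 _) (bdd_int_exp hf h2 _),
      integral_congr_ae (μ := H') (g := fun _ => exp L) (by filter_upwards [hH'] with t ht; rw [ht])] at e1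
    simpa using e1
  rw [← hV]
  have hnn := gibbs P Q hac hi
  suffices klG ε x y = ENNReal.ofReal (∫ t, llr P Q t ∂P) by
    rw [this, ENNReal.toReal_ofReal hnn]
  apply le_antisymm
  · refine (iInf_le_of_le H <| iInf_le_of_le inferInstance <| iInf_le_of_le H' <|
      iInf_le_of_le inferInstance ?_)
    rw [KLdiv, if_pos ⟨hac, hi⟩]; rfl
  · refine le_iInf fun K => le_iInf fun iK => le_iInf fun K' => le_iInf fun iK' => ?_
    have iP2 := mix_prob hε (gaussianReal x 1) K
    have iQ2 := mix_prob hε (gaussianReal y 1) K'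
    rw [KLdiv]
    split_ifs with hc
    · apply ENNReal.ofReal_le_ofReal
      have hh := dv _ _ hc.1 hc.2 (bdd_int hf h1 h2 _) (bdd_int_exp hf h2 _)
      refine le_trans ?_ hh
      rw [integral_mix hε _ _ hfx (bdd_int hf h1 h2 _),
        integral_mix hε _ _ (bdd_int_exp hf h2 _) (bdd_int_exp hf h2 _), hV]
      have g1 : -L ≤ ∫ t, f t ∂K := by
        have := integral_mono (integrable_const (-L)) (bdd_int hf h1 h2 K) h1
        simpa using this
      have g2 : ∫ t, exp (f t) ∂K' ≤ exp L := by
        have := integral_mono (bdd_int_exp hf h2 K') (integrable_const (exp L))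
          (fun t => exp_le_exp.2 (h2 t))
        simpa using this
      have := mul_le_mul_of_nonneg_left g1 hε.1.le
      have := mul_le_mul_of_nonneg_left g2 hε.1.le
      linarith
    · exact le_top

/-- The excess density. -/
def exD (k c m1 m2 : ℝ) (S : Set ℝ) : ℝ → ℝ :=
  S.indicator fun t => k * (c * gaussianPDFReal m1 1 t - gaussianPDFReal m2 1 t)

lemma exD_meas (k c m1 m2 : ℝ) {S : Set ℝ} (hS : MeasurableSet S) :
    Measurable (exD k c m1 m2 S) := by
  unfold exD
  refine Measurable.indicator ?_ hS
  have := measurable_gaussianPDFReal m1 1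
  have := measurable_gaussianPDFReal m2 1
  fun_prop

lemma gauss_set (m : ℝ) (S : Set ℝ) :
    ∫ t in S, gaussianPDFReal m 1 t = (gaussianReal m 1).real S := by
  rw [measureReal_def, gaussianReal_apply_eq_integral m one_ne_zero, ENNReal.toReal_ofReal]
  exact integral_nonneg fun t => gaussianPDFReal_nonneg _ _ _

lemma exD_prob (k c m1 m2 : ℝ) {S : Set ℝ} (hS : MeasurableSet S)
    (h0 : ∀ t, 0 ≤ exD k c m1 m2 S t)
    (h1 : k * (c * (gaussianReal m1 1).real S - (gaussianReal m2 1).real S) = 1) :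
    IsProbabilityMeasure (volume.withDensity fun t => ENNReal.ofReal (exD k c m1 m2 S t)) := by
  constructor
  have i1 := integrable_gaussianPDFReal m1 1
  have i2 := integrable_gaussianPDFReal m2 1
  have i3 : Integrable (fun t => k * (c * gaussianPDFReal m1 1 t - gaussianPDFReal m2 1 t)) :=
    ((i1.const_mul c).sub i2).const_mul k
  rw [withDensity_apply _ MeasurableSet.univ, Measure.restrict_univ]
  unfold exD at h0 ⊢
  rw [← ofReal_integral_eq_lintegral_ofReal (i3.indicator hS) (Filter.Eventually.of_forall h0)]
  rw [integral_indicator hS, integral_const_mul, integral_sub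
    (i1.const_mul c).integrableOn i2.integrableOn, integral_const_mul, gauss_set, gauss_set, h1]
  simp

lemma mix_eq {ε : ℝ} (hε : ε ∈ Set.Ioo (0 : ℝ) 1) (m : ℝ) {h : ℝ → ℝ} (hm : Measurable h)
    (h0 : ∀ t, 0 ≤ h t) :
    mix ε (gaussianReal m 1) (volume.withDensity fun t => ENNReal.ofReal (h t)) =
      volume.withDensity fun t => ENNReal.ofReal ((1 - ε) * gaussianPDFReal m 1 t + ε * h t) := by
  have hg := measurable_gaussianPDFReal m 1
  have e : (fun t => ENNReal.ofReal ((1 - ε) * gaussianPDFReal m 1 t + ε * h t)) =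
      (ENNReal.ofReal (1 - ε) • gaussianPDF m 1) +
        (ENNReal.ofReal ε • fun t => ENNReal.ofReal (h t)) := by
    ext t
    simp only [Pi.add_apply, Pi.smul_apply, smul_eq_mul, gaussianPDF]
    have := gaussianPDFReal_nonneg m 1 t
    have h3 : 0 ≤ 1 - ε := by linarith [hε.2]
    rw [ENNReal.ofReal_add (mul_nonneg h3 this) (mul_nonneg hε.1.le (h0 t)),
      ENNReal.ofReal_mul h3, ENNReal.ofReal_mul hε.1.le]
  rw [e, withDensity_add_left ((measurable_gaussianPDF m 1).const_smul _),
    withDensity_smul _ (measurable_gaussianPDF m 1), withDensity_smul _ (by fun_prop), mix,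
    gaussianReal_of_var_ne_zero m one_ne_zero]

/-- The clipped log-likelihood ratio. -/
def clipF (x d L t : ℝ) : ℝ := max (-L) (min L (d ^ 2 / 2 - d * (t - x)))

lemma clipF_left {x d L t : ℝ} (hd : 0 < d) (hL : 0 < L) (h : t ≤ x + (d / 2 - L / d)) :
    L ≤ d ^ 2 / 2 - d * (t - x) ∧ clipF x d L t = L := by
  have : L ≤ d ^ 2 / 2 - d * (t - x) := by
    have h2 : d * (t - x) ≤ d * (d / 2 - L / d) := mul_le_mul_of_nonneg_left (by linarith) hd.le
    have h3 : d * (d / 2 - L / d) = d ^ 2 / 2 - L := by field_simp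
    linarith
  exact ⟨this, by rw [clipF, min_eq_left this, max_eq_right (by linarith)]⟩

lemma clipF_right {x d L t : ℝ} (hd : 0 < d) (hL : 0 < L) (h : x + (d / 2 + L / d) ≤ t) :
    d ^ 2 / 2 - d * (t - x) ≤ -L ∧ clipF x d L t = -L := by
  have : d ^ 2 / 2 - d * (t - x) ≤ -L := by
    have h2 : d * (d / 2 + L / d) ≤ d * (t - x) := by gcongr; linarith
    have h3 : d * (d / 2 + L / d) = d ^ 2 / 2 + L := by field_simp
    linarith
  exact ⟨this, by rw [clipF, min_eq_right (by linarith), max_eq_left (by linarith)]⟩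

lemma clipF_mid {x d L t : ℝ} (hd : 0 < d) (h1 : x + (d / 2 - L / d) ≤ t)
    (h2 : t ≤ x + (d / 2 + L / d)) :
    clipF x d L t = d ^ 2 / 2 - d * (t - x) := by
  have h3 : d * (d / 2 + L / d) = d ^ 2 / 2 + L := by field_simp
  have h4 : d * (d / 2 - L / d) = d ^ 2 / 2 - L := by field_simp
  have h5 : d * (t - x) ≤ d * (d / 2 + L / d) := by gcongr; linarith
  have h6 : d * (d / 2 - L / d) ≤ d * (t - x) := mul_le_mul_of_nonneg_left (by linarith) hd.le
  rw [clipF, min_eq_right (by linarith), max_eq_right (by linarith)]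

lemma pq_ratio (x d t : ℝ) : gaussianPDFReal x 1 t =
    gaussianPDFReal (x + d) 1 t * exp (d ^ 2 / 2 - d * (t - x)) := by
  simp only [gaussianPDFReal]
  rw [mul_assoc _ (exp _) (exp _), ← exp_add]
  congr 2
  push_cast
  ring

lemma clip_integral (x d L : ℝ) (hd : 0 < d) (hL : 0 < L) :
    ∫ t, clipF x d L t ∂(gaussianReal x 1) =
      L * stdPhi (d / 2 - L / d) - L * (1 - stdPhi (d / 2 + L / d)) +
      (d ^ 2 / 2 * (stdPhi (d / 2 + L / d) - stdPhi (d / 2 - L / d)) +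
        d * (stdphi (d / 2 + L / d) - stdphi (d / 2 - L / d))) := by
  set a := d / 2 - L / d with ha
  set b := d / 2 + L / d with hb
  have hab : a ≤ b := by have : 0 < L / d := by positivity
                         linarith
  have hm : Measurable (clipF x d L) := by unfold clipF; fun_prop
  have hm0 : Measurable (clipF 0 d L) := by unfold clipF; fun_prop
  have hi : Integrable (clipF 0 d L) (gaussianReal 0 1) := by
    refine bdd_int hm0 (L := L) (fun t => le_max_left _ _) (fun t => ?_) _
    exact max_le (by linarith) (min_le_left _ _)
  have h := gaussianReal_map_add_const (μ := 0) (v := 1) x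
  rw [zero_add] at h
  rw [← h, integral_map (by fun_prop) hm.aestronglyMeasurable]
  have e0 : (fun t => clipF x d L (t + x)) = clipF 0 d L := by ext t; simp [clipF]
  rw [e0, ← integral_add_compl (measurableSet_Iic (a := b)) hi, ← Iic_union_Ioc_eq_Iic hab,
    setIntegral_union (Iic_disjoint_Ioc le_rfl) measurableSet_Ioc hi.integrableOn hi.integrableOn,
    Iic_union_Ioc_eq_Iic hab, compl_Iic]
  have e1 : ∫ t in Iic a, clipF 0 d L t ∂(gaussianReal 0 1) = L * stdPhi a := by
    rw [setIntegral_congr_fun (g := fun _ => L) measurableSet_Iic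
      (fun t ht => (clipF_left hd hL (by simpa using! ht)).2), setIntegral_const, gauss_Iic]
    simp [mul_comm]
  have e2 : ∫ t in Ioi b, clipF 0 d L t ∂(gaussianReal 0 1) = - L * (1 - stdPhi b) := by
    rw [setIntegral_congr_fun (g := fun _ => -L) measurableSet_Ioi
      (fun t ht => (clipF_right hd hL (by simpa using! (le_of_lt ht))).2), setIntegral_const,
      gauss_Ioi]
    simp [mul_comm]
  have e3 : ∫ t in Ioc a b, clipF 0 d L t ∂(gaussianReal 0 1) =
      d ^ 2 / 2 * (stdPhi b - stdPhi a) + d * (stdphi b - stdphi a) := by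
    rw [setIntegral_congr_fun (g := fun t => d ^ 2 / 2 - d * t) measurableSet_Ioc
      (fun t ht => by simpa using (clipF_mid (x := 0) hd (by rw [zero_add]; exact ht.1.le)
        (by rw [zero_add]; exact ht.2)))]
    rw [← integral_indicator measurableSet_Ioc, integral_gaussianReal_eq_integral_smul one_ne_zero]
    have : (fun t => gaussianPDFReal 0 1 t • (Ioc a b).indicator (fun t => d ^ 2 / 2 - d * t) t) =
        (Ioc a b).indicator fun t => stdphi t * (d ^ 2 / 2 - d * t) := by
      ext t
      rw [← stdphi_eq]
      by_cases ht : t ∈ Ioc a b <;> simp [ht]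
    rw [this, integral_indicator measurableSet_Ioc, ← intervalIntegral.integral_of_le hab,
      intervalIntegral.integral_eq_sub_of_hasDerivAt
        (f := fun t => d ^ 2 / 2 * stdPhi t + d * stdphi t)]
    · ring
    · intro t _
      refine (((stdPhi_strictDeriv t).hasDerivAt.const_mul (d ^ 2 / 2)).add
        ((stdphi_strictDeriv t).hasDerivAt.const_mul d)).congr_deriv ?_
      ring
    · have := stdphi_cont
      exact Continuous.intervalIntegrable (by fun_prop) _ _
  rw [e1, e2, e3]; ring

/-- The mass function `F`. -/
def massF (d L : ℝ) : ℝ := exp (-L) * stdPhi (d / 2 - L / d) + stdPhi (d / 2 + L / d)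

/-- The closed form. -/
def closedK (d L : ℝ) : ℝ :=
  (1 - exp (-L)) * stdPhi (d / 2 - L / d) * L +
    d ^ 2 / 2 * (stdPhi (d / 2 + L / d) - stdPhi (d / 2 - L / d)) -
    d * (stdphi (d / 2 - L / d) - stdphi (d / 2 + L / d))

lemma klG_closed {ε x d L : ℝ} (hε : ε ∈ Set.Ioo (0 : ℝ) 1) (hd : 0 < d) (hL : 0 < L)
    (hF : massF d L = 1 / (1 - ε)) :
    (klG ε x (x + d)).toReal = (1 - ε) * closedK d L := by
  obtain ⟨hε0, hε1⟩ := id hε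
  have hk : 0 < (1 - ε) / ε := div_pos (by linarith) hε0
  have hF' : (1 - ε) * massF d L = 1 := by
    rw [hF]; field_simp [show (1 - ε) ≠ 0 by linarith]
  have hab : d / 2 - L / d < d / 2 + L / d := by
    have : 0 < L / d := by positivity
    linarith
  set S := Ici (x + (d / 2 + L / d)) with hS
  set T := Iic (x + (d / 2 - L / d)) with hT
  have hSm : MeasurableSet S := measurableSet_Ici
  have hTm : MeasurableSet T := measurableSet_Iic
  set h := exD ((1 - ε) / ε) (exp (-L)) (x + d) x S with hh
  set h' := exD ((1 - ε) / ε) (exp (-L)) x (x + d) T with hh'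
  have q0 := fun t => gaussianPDFReal_nonneg (x + d) 1 t
  have hS0 : ∀ t, 0 ≤ h t := by
    intro t
    refine indicator_nonneg (fun t ht => ?_) t
    have h1 := (clipF_right hd hL ht).1
    rw [pq_ratio x d t]
    refine mul_nonneg hk.le ?_
    have := mul_le_mul_of_nonneg_left (exp_le_exp.2 h1) (q0 t)
    linarith
  have hT0 : ∀ t, 0 ≤ h' t := by
    intro t
    refine indicator_nonneg (fun t ht => ?_) t
    have h1 := (clipF_left hd hL ht).1
    rw [pq_ratio x d t]
    refine mul_nonneg hk.le ?_
    have := mul_le_mul_of_nonneg_left (exp_le_exp.2 h1) (q0 t)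
    have h3 := mul_le_mul_of_nonneg_left this (exp_pos (-L)).le
    have h4 : exp (-L) * (gaussianPDFReal (x + d) 1 t * exp L) = gaussianPDFReal (x + d) 1 t := by
      rw [mul_comm, mul_assoc, ← exp_add]; simp
    linarith
  have iH := exD_prob ((1 - ε) / ε) (exp (-L)) (x + d) x hSm hS0 (by
    rw [gauss_Ici, gauss_Ici, show x + (d / 2 + L / d) - (x + d) = -(d / 2 - L / d) by ring,
      stdPhi_neg, show x + (d / 2 + L / d) - x = d / 2 + L / d by ring]
    rw [massF] at hF'
    rw [div_mul_eq_mul_div, div_eq_one_iff_eq hε0.ne']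
    linarith)
  have iH' := exD_prob ((1 - ε) / ε) (exp (-L)) x (x + d) hTm hT0 (by
    rw [gauss_Iic, gauss_Iic, show x + (d / 2 - L / d) - (x + d) = -(d / 2 + L / d) by ring,
      stdPhi_neg, show x + (d / 2 - L / d) - x = d / 2 - L / d by ring]
    rw [massF] at hF'
    rw [div_mul_eq_mul_div, div_eq_one_iff_eq hε0.ne']
    linarith)
  have hm := exD_meas ((1 - ε) / ε) (exp (-L)) (x + d) x hSm
  have hm' := exD_meas ((1 - ε) / ε) (exp (-L)) x (x + d) hTm
  rw [← hh] at iH hm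
  rw [← hh'] at iH' hm'
  have hfm : Measurable (clipF x d L) := by unfold clipF; fun_prop
  have key := klG_eq (x := x) (y := x + d) (L := L) hε
    (volume.withDensity fun t => ENNReal.ofReal (h t))
    (volume.withDensity fun t => ENNReal.ofReal (h' t)) hfm
    (fun t => le_max_left _ _) (fun t => max_le (by linarith) (min_le_left _ _)) ?_ ?_ ?_
  · rw [key, clip_integral x d L hd hL, closedK]
    rw [massF] at hF'
    linear_combination L * hF'
  · rw [ae_withDensity_iff (by fun_prop)]
    refine Filter.Eventually.of_forall fun t ht => ?_
    by_cases hts : t ∈ S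
    · exact (clipF_right hd hL hts).2
    · simp [hh, exD, hts] at ht
  · rw [ae_withDensity_iff (by fun_prop)]
    refine Filter.Eventually.of_forall fun t ht => ?_
    by_cases hts : t ∈ T
    · exact (clipF_left hd hL hts).2
    · simp [hh', exD, hts] at ht
  · have g1 := measurable_gaussianPDFReal x 1
    have g2 := measurable_gaussianPDFReal (x + d) 1
    rw [mix_eq hε x hm hS0, mix_eq hε (x + d) hm' hT0, ← withDensity_mul _ (by fun_prop)
      (by fun_prop)]
    congr 1
    ext t
    simp only [Pi.mul_apply]
    rw [← ENNReal.ofReal_mul (add_nonneg (mul_nonneg (by linarith) (q0 t))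
      (mul_nonneg hε0.le (hT0 t)))]
    congr 1
    have hεk : ∀ u, ε * ((1 - ε) / ε * u) = (1 - ε) * u := fun u => by field_simp
    have hLL : exp (-L) * exp L = 1 := by rw [← exp_add]; simp
    by_cases hts : t ∈ S
    · have htt : t ∉ T := fun h2 => by
        simp only [hS, hT, mem_Ici, mem_Iic] at hts h2; linarith
      rw [(clipF_right hd hL hts).2]
      simp only [hh, hh', exD, indicator_of_mem hts, indicator_of_notMem htt, hεk]
      ring
    · by_cases htt : t ∈ T
      · rw [(clipF_left hd hL htt).2]
        simp only [hh, hh', exD, indicator_of_notMem hts, indicator_of_mem htt, hεk]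
        linear_combination (-(1 - ε) * gaussianPDFReal x 1 t) * hLL
      · simp only [hh, hh', exD, indicator_of_notMem hts, indicator_of_notMem htt]
        simp only [hS, hT, mem_Ici, mem_Iic, not_le] at hts htt
        rw [clipF_mid hd htt.le hts.le, pq_ratio x d t]
        ring

lemma phi_ratio {d L : ℝ} (hd : 0 < d) :
    stdphi (d / 2 + L / d) = exp (-L) * stdphi (d / 2 - L / d) := by
  unfold stdphi
  rw [mul_left_comm, ← exp_add]
  congr 2
  field_simp
  ring

lemma massF_deriv_L (d : ℝ) (hd : 0 < d) (L : ℝ) :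
    HasDerivAt (massF d) (-(exp (-L) * stdPhi (d / 2 - L / d))) L := by
  have h1 : HasDerivAt (fun L => d / 2 - L / d) (-(1 / d)) L :=
    ((hasDerivAt_id L).div_const d).const_sub (d / 2)
  have h2 : HasDerivAt (fun L => d / 2 + L / d) (1 / d) L :=
    ((hasDerivAt_id L).div_const d).const_add (d / 2)
  have h3 := (stdPhi_strictDeriv (d / 2 - L / d)).hasDerivAt.comp L h1
  have h4 := (stdPhi_strictDeriv (d / 2 + L / d)).hasDerivAt.comp L h2
  have h5 : HasDerivAt (fun L : ℝ => exp (-L)) (exp (-L) * (-1)) L := (hasDerivAt_id L).neg.exp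
  refine ((h5.mul h3).add h4).congr_deriv ?_
  rw [phi_ratio hd]
  simp only [Function.comp]
  ring

lemma massF_anti (d : ℝ) (hd : 0 < d) : StrictAnti (massF d) := by
  apply strictAnti_of_deriv_neg
  intro L
  rw [(massF_deriv_L d hd L).deriv]
  have := mul_pos (exp_pos (-L)) (stdPhi_pos (d / 2 - L / d))
  linarith

lemma massF_contDiff {d : ℝ} (hd : 0 < d) (L : ℝ) :
    HasStrictFDerivAt (fun v : ℝ × ℝ => massF v.1 v.2)
      ((exp (-L) * stdphi (d / 2 - L / d)) • ContinuousLinearMap.fst ℝ ℝ ℝ +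
        (-(exp (-L) * stdPhi (d / 2 - L / d))) • ContinuousLinearMap.snd ℝ ℝ ℝ) (d, L) := by
  have f1 : HasStrictFDerivAt (fun v : ℝ × ℝ => v.1) (ContinuousLinearMap.fst ℝ ℝ ℝ) (d, L) :=
    hasStrictFDerivAt_fst
  have f2 : HasStrictFDerivAt (fun v : ℝ × ℝ => v.2) (ContinuousLinearMap.snd ℝ ℝ ℝ) (d, L) :=
    hasStrictFDerivAt_snd
  have hinv := (hasStrictDerivAt_inv hd.ne').comp_hasStrictFDerivAt_of_eq (d, L) f1 rfl
  have hA := (f1.const_mul (1 / 2)).sub (f2.mul hinv)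
  have hB := (f1.const_mul (1 / 2)).add (f2.mul hinv)
  have e1 : (1 / 2) * d - L * d⁻¹ = d / 2 - L / d := by ring
  have e2 : (1 / 2) * d + L * d⁻¹ = d / 2 + L / d := by ring
  have h3 := (stdPhi_strictDeriv (d / 2 - L / d)).comp_hasStrictFDerivAt_of_eq (d, L) hA e1.symm
  have h4 := (stdPhi_strictDeriv (d / 2 + L / d)).comp_hasStrictFDerivAt_of_eq (d, L) hB e2.symm
  have h5 := (Real.hasStrictDerivAt_exp (-L)).comp_hasStrictFDerivAt_of_eq (d, L) f2.neg rfl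
  have h6 := (h5.mul h3).add h4
  refine (h6.congr_of_eventuallyEq ?_).congr_fderiv ?_
  · refine Filter.Eventually.of_forall fun v => ?_
    simp only [massF, Function.comp, Pi.add_apply, Pi.mul_apply, Pi.sub_apply, Pi.neg_apply]
    ring_nf
  · ext
    · simp [phi_ratio hd]
      field_simp
      ring
    · simp [phi_ratio hd]
      field_simp
      ring_nf

lemma closedK_deriv {g : ℝ → ℝ} {d g' : ℝ} (hd : 0 < d) (hg : HasDerivAt g g' d)
    (hg' : g' * stdPhi (d / 2 - g d / d) = stdphi (d / 2 - g d / d)) :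
    HasDerivAt (fun t => closedK t (g t))
      (d * (stdPhi (d / 2 + g d / d) - stdPhi (d / 2 - g d / d))) d := by
  have hq := hg.div (hasDerivAt_id d) hd.ne'
  have hA : HasDerivAt (fun t => t / 2 - g t / t) _ d := ((hasDerivAt_id d).div_const 2).sub hq
  have hB : HasDerivAt (fun t => t / 2 + g t / t) _ d := ((hasDerivAt_id d).div_const 2).add hq
  have PA := (stdPhi_strictDeriv (d / 2 - g d / d)).hasDerivAt.comp d hA
  have PB := (stdPhi_strictDeriv (d / 2 + g d / d)).hasDerivAt.comp d hB
  have pA := (stdphi_strictDeriv (d / 2 - g d / d)).hasDerivAt.comp d hA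
  have pB := (stdphi_strictDeriv (d / 2 + g d / d)).hasDerivAt.comp d hB
  have hE := (hg.neg.exp).const_sub 1
  have hS := (((hasDerivAt_id d).pow 2).div_const 2)
  have := (((hE.mul PA).mul hg).add (hS.mul (PB.sub PA))).sub ((hasDerivAt_id d).mul (pA.sub pB))
  refine this.congr_deriv ?_
  simp only [Function.comp, Pi.mul_apply, Pi.sub_apply, Pi.neg_apply, Pi.pow_apply, id]
  rw [phi_ratio hd]
  set A := stdPhi (d / 2 - g d / d)
  set B := stdPhi (d / 2 + g d / d)
  set p := stdphi (d / 2 - g d / d)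
  set E := exp (-g d)
  rw [← hg']
  push_cast
  field_simp
  ring

/-- derivative of `Δ ↦ kl^ε_G(x, x+Δ)` above the minimum gap, and its
positivity. -/
theorem klG_hasDerivAt (ε x Δ c : ℝ) (hε : ε ∈ Set.Ioo (0 : ℝ) (1 / 2))
    (hΔ : Dmin ε < Δ) (hc : 0 < c)
    (hceq : 1 / (1 - ε) =
      c * stdPhi ((Δ - 2 / Δ * Real.log (1 / c)) / 2) +
        stdPhi ((Δ + 2 / Δ * Real.log (1 / c)) / 2)) :
    HasDerivAt (fun d => (klG ε x (x + d)).toReal)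
        ((1 - ε) * Δ * (stdPhi ((Δ + 2 / Δ * Real.log (1 / c)) / 2) -
          stdPhi ((Δ - 2 / Δ * Real.log (1 / c)) / 2))) Δ ∧
      0 < (1 - ε) * Δ * (stdPhi ((Δ + 2 / Δ * Real.log (1 / c)) / 2) -
        stdPhi ((Δ - 2 / Δ * Real.log (1 / c)) / 2)) := by
  have hε' : ε ∈ Set.Ioo (0 : ℝ) 1 := ⟨hε.1, by linarith [hε.2]⟩
  obtain ⟨hd, hhalf⟩ := half_lt_of_Dmin hε hΔ
  set L := Real.log (1 / c) with hLdef
  have hcL : exp (-L) = c := by rw [hLdef, one_div, Real.log_inv, neg_neg, exp_log hc]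
  have e1 : (Δ - 2 / Δ * L) / 2 = Δ / 2 - L / Δ := by ring
  have e2 : (Δ + 2 / Δ * L) / 2 = Δ / 2 + L / Δ := by ring
  rw [e1, e2] at hceq ⊢
  have hF : massF Δ L = 1 / (1 - ε) := by rw [hceq, massF, hcL]
  have hL : 0 < L := by
    apply (massF_anti Δ hd).lt_iff_gt.1
    rw [hF]
    simpa [massF, two_mul] using hhalf
  have hab : Δ / 2 - L / Δ < Δ / 2 + L / Δ := by
    have : 0 < L / Δ := by positivity
    linarith
  have hε1 : 0 < 1 - ε := by linarith [hε'.2]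
  refine ⟨?_, mul_pos (mul_pos hε1 hd) (sub_pos.2 (stdPhi_strictMono hab))⟩
  have hP := stdPhi_pos (Δ / 2 - L / Δ)
  have hs := massF_contDiff hd L
  have hinv : ((((exp (-L) * stdphi (Δ / 2 - L / Δ)) • ContinuousLinearMap.fst ℝ ℝ ℝ +
        (-(exp (-L) * stdPhi (Δ / 2 - L / Δ))) • ContinuousLinearMap.snd ℝ ℝ ℝ)) ∘L
        ContinuousLinearMap.inr ℝ ℝ ℝ).IsInvertible := by
    have hne : -(exp (-L) * stdPhi (Δ / 2 - L / Δ)) ≠ 0 :=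
      neg_ne_zero.2 (mul_pos (exp_pos _) hP).ne'
    refine ⟨ContinuousLinearEquiv.unitsEquivAut ℝ (Units.mk0 _ hne), ?_⟩
    ext
    simp
  set g := hs.implicitFunctionOfProdDomain hinv with hg
  have hgd := (hs.hasStrictFDerivAt_implicitFunctionOfProdDomain hinv).hasFDerivAt.hasDerivAt
  have hgt := hs.tendsto_implicitFunctionOfProdDomain hinv
  have hge := hs.eventually_apply_implicitFunctionOfProdDomain hinv
  rw [← hg] at hgd hgt hge
  simp only at hgd hgt hge
  have hgΔ : g Δ = L :=
    tendsto_nhds_unique (hgd.continuousAt.tendsto) hgt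
  have hd' : HasDerivAt (fun t => massF t (g t)) 0 Δ := by
    refine (hasDerivAt_const Δ (massF Δ L)).congr_of_eventuallyEq ?_
    exact hge
  have hpair := (hasDerivAt_id Δ).prodMk hgd
  have hcomp := (hs.hasFDerivAt).comp_hasDerivAt_of_eq Δ hpair (by simp [hgΔ])
  have huniq := hcomp.unique hd'
  set g' := (-((((exp (-L) * stdphi (Δ / 2 - L / Δ)) • ContinuousLinearMap.fst ℝ ℝ ℝ +
        (-(exp (-L) * stdPhi (Δ / 2 - L / Δ))) • ContinuousLinearMap.snd ℝ ℝ ℝ)) ∘L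
        ContinuousLinearMap.inr ℝ ℝ ℝ).inverse ∘L ((((exp (-L) * stdphi (Δ / 2 - L / Δ)) • ContinuousLinearMap.fst ℝ ℝ ℝ +
        (-(exp (-L) * stdPhi (Δ / 2 - L / Δ))) • ContinuousLinearMap.snd ℝ ℝ ℝ)) ∘L
        ContinuousLinearMap.inl ℝ ℝ ℝ)) 1 with hg'
  have hrel : g' * stdPhi (Δ / 2 - g Δ / Δ) = stdphi (Δ / 2 - g Δ / Δ) := by
    rw [hgΔ]
    have h2 : exp (-L) * (stdphi (Δ / 2 - L / Δ) - g' * stdPhi (Δ / 2 - L / Δ)) = 0 := by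
      rw [← huniq]
      simp only [_root_.add_apply, _root_.smul_apply,
        ContinuousLinearMap.coe_fst', ContinuousLinearMap.coe_snd', smul_eq_mul]
      ring
    have := (mul_eq_zero.1 h2).resolve_left (exp_pos _).ne'
    linarith
  have hK := (closedK_deriv hd hgd hrel).const_mul (1 - ε)
  rw [hgΔ, ← mul_assoc] at hK
  refine hK.congr_of_eventuallyEq ?_
  filter_upwards [hge, hgt.eventually (lt_mem_nhds hL), lt_mem_nhds hd] with t h1 h2 h3
  exact klG_closed hε' h3 h2 (h1.trans hF)
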